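/- The set B_2 ∩ (q_f, q_KL) is countably infinite, where q_f is the root in (1,2) of x³ = 2x² − x + 1 and q_KL is the Komornik–Loreti constant. In particular, for each n ≥ 2 the algebraic number q_f^(n) defined by 1 = Σ_{i=1}^{2^n} 𝔪_i (q_f^(n))^{-i} (where (𝔪_i) is the Thue–Morse sequence) belongs to B_2, and q_f^(n) increases to q_KL as n → ∞. -/

import Mathlib

noncomputable section

/-- `a` is an expansion of `x` in base `q`: all digits `a n` lie in `{0,1}` and
`x = Σ_{n≥1} a_n q^{-n}` (here `a n` is the `(n+1)`-st digit, i.e. indexing is 0-based). -/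
def IsExpansion (q x : ℝ) (a : ℕ → ℕ) : Prop :=
  (∀ n, a n ≤ 1) ∧ x = ∑' n : ℕ, (a n : ℝ) / q ^ (n + 1)

/-- The set of expansions of `x` in base `q`. -/
def expansionsOf (q x : ℝ) : Set (ℕ → ℕ) := {a | IsExpansion q x a}

/-- `U_q`: the set of `x ∈ [0, 1/(q-1)]` having a unique expansion in base `q`. -/
def uniqueExpansionSet (q : ℝ) : Set ℝ :=
  {x | x ∈ Set.Icc 0 (1 / (q - 1)) ∧ ∃! a, IsExpansion q x a}

/-- `B_m` (for finite `m`): bases `q ∈ (G, 2)` for which some `x ∈ I_q` has exactly `m`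
expansions in base `q`. -/
def B (m : ℕ) : Set ℝ :=
  {q | q ∈ Set.Ioo ((1 + Real.sqrt 5) / 2) 2 ∧
    ∃ x ∈ Set.Icc (0:ℝ) (1 / (q - 1)), Cardinal.mk (expansionsOf q x) = m}

/-- `B_{ℵ₀}`: bases `q ∈ (G, 2)` for which some `x ∈ I_q` has exactly countably infinitely
many expansions in base `q`. -/
def Baleph0 : Set ℝ :=
  {q | q ∈ Set.Ioo ((1 + Real.sqrt 5) / 2) 2 ∧
    ∃ x ∈ Set.Icc (0:ℝ) (1 / (q - 1)), Cardinal.mk (expansionsOf q x) = Cardinal.aleph0}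

/-- The Thue–Morse sequence: `thueMorse n` is the parity of the number of 1s in the
binary expansion of `n`. -/
def thueMorse (n : ℕ) : ℕ := ((Nat.digits 2 n).count 1) % 2

/-- A digit `a m` of an expansion of `x` in base `q` is forced if every expansion of `x`
agreeing with `a` before position `m` also agrees at position `m`. -/
def Forced (q x : ℝ) (a : ℕ → ℕ) (m : ℕ) : Prop :=
  ∀ c : ℕ → ℕ, IsExpansion q x c → (∀ i < m, c i = a i) → c m = a m

theorem thueMorse_zero : thueMorse 0 = 0 := by simp [thueMorse]

theorem thueMorse_le_one (n : ℕ) : thueMorse n ≤ 1 := by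
  unfold thueMorse; omega

theorem thueMorse_two_mul (n : ℕ) : thueMorse (2 * n) = thueMorse n := by
  rcases Nat.eq_zero_or_pos n with rfl | h
  · simp
  · unfold thueMorse
    rw [Nat.digits_def' (by norm_num) (by omega : 0 < 2 * n)]
    simp

theorem thueMorse_two_mul_add_one (n : ℕ) : thueMorse (2 * n + 1) = 1 - thueMorse n := by
  unfold thueMorse
  rw [Nat.digits_def' (by norm_num) (by omega : 0 < 2 * n + 1),
    show (2 * n + 1) % 2 = 1 by omega, show (2 * n + 1) / 2 = n by omega, List.count_cons_self]
  omega

theorem thueMorse_two_pow_add (n i : ℕ) (hi : i < 2 ^ n) :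
    thueMorse (2 ^ n + i) = 1 - thueMorse i := by
  induction n generalizing i with
  | zero =>
    obtain rfl : i = 0 := by simpa using hi
    simp [thueMorse]
  | succ n ih =>
    rw [pow_succ] at hi ⊢
    obtain ⟨j, rfl | rfl⟩ := Nat.even_or_odd' i
    · rw [show 2 ^ n * 2 + 2 * j = 2 * (2 ^ n + j) by ring, thueMorse_two_mul, thueMorse_two_mul,
        ih j (by omega)]
    · rw [show 2 ^ n * 2 + (2 * j + 1) = 2 * (2 ^ n + j) + 1 by ring, thueMorse_two_mul_add_one,
        thueMorse_two_mul_add_one, ih j (by omega)]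

theorem thueMorse_two_pow (n : ℕ) : thueMorse (2 ^ n) = 1 := by
  simpa [thueMorse_zero] using thueMorse_two_pow_add n 0 (by positivity)

theorem thueMorse_one : thueMorse 1 = 1 := by simpa using thueMorse_two_pow 0

theorem thueMorse_two : thueMorse 2 = 1 := by simpa using thueMorse_two_pow 1

/-- Starting at `k`, the word `a k, a (k+1), …`, normalized to start with `0`, first departs from
the Thue–Morse word at one of the positions `1, …, N`, and it is smaller there. -/
def BelowThueMorse (a : ℕ → ℕ) (N k : ℕ) : Prop :=
  ∃ i, 1 ≤ i ∧ i ≤ N ∧ thueMorse i = 1 ∧ a (k + i) = a k ∧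
    ∀ j < i, (a (k + j) = a k ↔ thueMorse j = 0)

/-- `a` is eventually periodic, with preperiod `N` and period `p`. -/
def EventuallyPeriodic (a : ℕ → ℕ) (N p : ℕ) : Prop :=
  0 < p ∧ ∀ k, N ≤ k → a (k + p) = a k

theorem EventuallyPeriodic.mono {a : ℕ → ℕ} {N p N' : ℕ} (h : EventuallyPeriodic a N p)
    (hN : N ≤ N') (m : ℕ) (hm : 0 < m) : EventuallyPeriodic a N' (p * m) := by
  refine ⟨Nat.mul_pos h.1 hm, fun k hk => ?_⟩
  clear hm
  induction m with
  | zero => simp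
  | succ m ih => rw [mul_add, mul_one, ← add_assoc, h.2 _ (by omega), ih]

/-- If a word repeats a full Thue–Morse block followed by its complement, this persists. -/
theorem thueMorse_block_succ {a : ℕ → ℕ} (ha : ∀ n, a n ≤ 1) {n k : ℕ}
    (h : ∀ k, BelowThueMorse a (2 ^ (n + 1)) k)
    (hk : ∀ j ≤ 2 ^ n, (a (k + j) = a k ↔ thueMorse j = 0)) :
    ∀ j ≤ 2 ^ n, (a (k + 2 ^ n + j) = a (k + 2 ^ n) ↔ thueMorse j = 0) := by
  obtain ⟨i, hi1, hiN, hti, hai, hij⟩ := h k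
  obtain ⟨i', hi1', hiN', hti', hai', hij'⟩ := h (k + 2 ^ n)
  have hp := thueMorse_two_pow n
  have hpos : 0 < 2 ^ n := by positivity
  have e1 := hk (2 ^ n) le_rfl
  have hlt : 2 ^ n < i := by
    by_contra hcon
    have := hk i (by omega)
    omega
  have hi'lt : 2 ^ n < i' := by
    by_contra hcon
    have b0 := ha k
    have b1 := ha (k + 2 ^ n)
    have b2 := ha (k + 2 ^ n + i')
    rw [pow_succ] at hiN
    rcases lt_trichotomy (2 ^ n + i') i with hc | hc | hc
    · have e2 := hij _ hc
      rw [← add_assoc] at e2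
      rcases Nat.lt_or_ge i' (2 ^ n) with hd | hd
      · have := thueMorse_two_pow_add n i' hd
        omega
      · omega
    · rw [← hc, ← add_assoc] at hai
      omega
    · have e2 := hij' (i - 2 ^ n) (by omega)
      have e3 := thueMorse_two_pow_add n (i - 2 ^ n) (by omega)
      rw [show 2 ^ n + (i - 2 ^ n) = i by omega] at e3
      rw [show k + 2 ^ n + (i - 2 ^ n) = k + i by omega] at e2
      have := thueMorse_le_one (i - 2 ^ n)
      omega
  exact fun j hj => hij' j (by omega)

theorem eventuallyPeriodic_of_belowThueMorse {a : ℕ → ℕ} (ha : ∀ n, a n ≤ 1) (n : ℕ)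
    (h : ∀ k, BelowThueMorse a (2 ^ n) k) : ∃ N p, EventuallyPeriodic a N p := by
  induction n with
  | zero =>
    refine ⟨0, 1, one_pos, fun k _ => ?_⟩
    obtain ⟨i, hi1, hiN, -, hai, -⟩ := h k
    obtain rfl : i = 1 := by rw [pow_zero] at hiN; omega
    exact hai
  | succ n ih =>
    by_cases hn : ∀ k, BelowThueMorse a (2 ^ n) k
    · exact ih hn
    obtain ⟨k, hk⟩ := not_forall.1 hn
    have hstart : ∀ j ≤ 2 ^ n, (a (k + j) = a k ↔ thueMorse j = 0) := by
      obtain ⟨i, hi1, hiN, hti, hai, hij⟩ := h k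
      intro j hj
      refine hij j ?_
      by_contra hcon
      exact hk ⟨i, hi1, by omega, hti, hai, hij⟩
    have hall : ∀ m, ∀ j ≤ 2 ^ n,
        (a (k + m * 2 ^ n + j) = a (k + m * 2 ^ n) ↔ thueMorse j = 0) := by
      intro m
      induction m with
      | zero => simpa using hstart
      | succ m ihm =>
        have := thueMorse_block_succ ha h ihm
        rwa [show k + m * 2 ^ n + 2 ^ n = k + (m + 1) * 2 ^ n by ring] at this
    have hpos : 0 < 2 ^ n := by positivity
    have hflip : ∀ x, a (k + x + 2 ^ n) ≠ a (k + x) := by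
      intro x
      have hx : x / 2 ^ n * 2 ^ n + x % 2 ^ n = x := Nat.div_add_mod' x (2 ^ n)
      have hr := (Nat.mod_lt x hpos).le
      have e1 := hall (x / 2 ^ n) _ hr
      have e2 := hall (x / 2 ^ n + 1) _ hr
      have e3 := hall (x / 2 ^ n) _ le_rfl
      rw [show k + (x / 2 ^ n + 1) * 2 ^ n + x % 2 ^ n
          = k + (x / 2 ^ n * 2 ^ n + x % 2 ^ n) + 2 ^ n by ring, hx,
        show k + (x / 2 ^ n + 1) * 2 ^ n = k + x / 2 ^ n * 2 ^ n + 2 ^ n by ring] at e2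
      rw [add_assoc k, hx] at e1
      have := thueMorse_two_pow n
      have := ha (k + x)
      have := ha (k + x + 2 ^ n)
      have := ha (k + x / 2 ^ n * 2 ^ n)
      have := ha (k + x / 2 ^ n * 2 ^ n + 2 ^ n)
      omega
    refine ⟨k, 2 ^ n + 2 ^ n, by omega, fun x hx => ?_⟩
    obtain ⟨y, rfl⟩ := Nat.exists_eq_add_of_le hx
    have e1 := hflip y
    have e2 := hflip (y + 2 ^ n)
    rw [← add_assoc] at e2
    rw [← add_assoc]
    have := ha (k + y)
    have := ha (k + y + 2 ^ n)
    have := ha (k + y + 2 ^ n + 2 ^ n)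
    omega

/-- The image of the word `1000…` under the `m`-th iterate of the Thue–Morse substitution
`0 ↦ 01`, `1 ↦ 10`. -/
def morseWord : ℕ → ℕ → ℕ
  | 0, k => if k = 0 then 1 else 0
  | m + 1, k => if k % 2 = 0 then morseWord m (k / 2) else 1 - morseWord m (k / 2)

theorem morseWord_even (m k : ℕ) : morseWord (m + 1) (2 * k) = morseWord m k := by
  simp [morseWord]

theorem morseWord_odd (m k : ℕ) : morseWord (m + 1) (2 * k + 1) = 1 - morseWord m k := by
  rw [morseWord, if_neg (by omega), show (2 * k + 1) / 2 = k by omega]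

theorem morseWord_le_one (m k : ℕ) : morseWord m k ≤ 1 := by
  induction m generalizing k with
  | zero => unfold morseWord; split <;> omega
  | succ m ih =>
    unfold morseWord
    split
    · exact ih _
    · omega

theorem morseWord_add_thueMorse (m k : ℕ) (hk : k ≤ 2 ^ (m + 1)) :
    morseWord m k + thueMorse k = 1 := by
  induction m generalizing k with
  | zero =>
    have := thueMorse_two
    obtain rfl | rfl | rfl : k = 0 ∨ k = 1 ∨ k = 2 := by
      rw [zero_add, pow_one] at hk; omega
    · simp [morseWord, thueMorse_zero]
    · simp [morseWord, thueMorse_one]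
    · simp [morseWord, this]
  | succ m ih =>
    rw [pow_succ] at hk
    obtain ⟨j, rfl | rfl⟩ := Nat.even_or_odd' k
    · rw [morseWord_even, thueMorse_two_mul]
      exact ih j (by omega)
    · rw [morseWord_odd, thueMorse_two_mul_add_one]
      have := ih j (by omega)
      omega

theorem morseWord_two_pow_add_one (m : ℕ) (hm : 1 ≤ m) :
    morseWord m (2 ^ (m + 1) + 1) = 1 := by
  obtain ⟨m, rfl⟩ := Nat.exists_eq_add_of_le' hm
  rw [pow_succ, mul_comm, morseWord_odd]
  have := morseWord_add_thueMorse m (2 ^ (m + 1)) le_rfl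
  rw [thueMorse_two_pow] at this
  omega

theorem belowThueMorse_morseWord (m k : ℕ) (hk : 1 ≤ k) :
    BelowThueMorse (morseWord m) (2 ^ m) k := by
  induction m generalizing k with
  | zero =>
    refine ⟨1, le_rfl, by simp, thueMorse_one, ?_, fun j hj => ?_⟩
    · rw [morseWord, morseWord, if_neg (by omega), if_neg (by omega)]
    · obtain rfl : j = 0 := by omega
      simp [thueMorse_zero]
  | succ m ih =>
    have hpos : 0 < 2 ^ m := by positivity
    obtain ⟨l, rfl | rfl⟩ := Nat.even_or_odd' k
    · obtain ⟨i, hi1, hiN, hti, hai, hij⟩ := ih l (by omega)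
      refine ⟨2 * i, by omega, by rw [pow_succ]; omega, by rwa [thueMorse_two_mul],
        by rwa [← mul_add, morseWord_even, morseWord_even], fun j hj => ?_⟩
      obtain ⟨j, rfl | rfl⟩ := Nat.even_or_odd' j
      · rw [← mul_add, morseWord_even, morseWord_even, thueMorse_two_mul]
        exact hij j (by omega)
      · rw [← add_assoc, ← mul_add, morseWord_even, morseWord_odd, thueMorse_two_mul_add_one]
        have := hij j (by omega)
        have := morseWord_le_one m (l + j)
        have := morseWord_le_one m l
        have := thueMorse_le_one j
        omega
    · have e0 := morseWord_odd m l
      have e1 := morseWord_even m (l + 1)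
      have e2 := morseWord_odd m (l + 1)
      rw [show 2 * (l + 1) = 2 * l + 1 + 1 by ring] at e1 e2
      have := morseWord_le_one m (l + 1)
      have := morseWord_le_one m l
      have h1 := thueMorse_one
      have h2 := thueMorse_two
      have h0 := thueMorse_zero
      by_cases hl : morseWord (m + 1) (2 * l + 1 + 1) = morseWord (m + 1) (2 * l + 1)
      · refine ⟨1, le_rfl, by rw [pow_succ]; omega, h1, hl, fun j hj => ?_⟩
        obtain rfl : j = 0 := by omega
        simp [h0]
      · refine ⟨2, by omega, by rw [pow_succ]; omega, h2, ?_, fun j hj => ?_⟩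
        · rw [show 2 * l + 1 + 2 = 2 * l + 1 + 1 + 1 by ring]
          omega
        · obtain rfl | rfl : j = 0 ∨ j = 1 := by omega
          · simp [h0]
          · omega

/-- The value in base `q` of the digit sequence `a k, a (k+1), …`. -/
def tailValue (q : ℝ) (a : ℕ → ℕ) (k : ℕ) : ℝ := ∑' n : ℕ, (a (k + n) : ℝ) / q ^ (n + 1)

theorem isExpansion_iff {q x : ℝ} {a : ℕ → ℕ} :
    IsExpansion q x a ↔ (∀ n, a n ≤ 1) ∧ x = tailValue q a 0 := by
  simp [IsExpansion, tailValue]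

section

variable {q : ℝ} {a : ℕ → ℕ}

theorem hasSum_one_div_pow_succ (hq : 1 < q) :
    HasSum (fun n : ℕ => 1 / q ^ (n + 1)) (1 / (q - 1)) := by
  have h := (hasSum_geometric_of_lt_one (r := q⁻¹) (by positivity)
    (inv_lt_one_of_one_lt₀ hq)).mul_left q⁻¹
  have hq0 : q ≠ 0 := by linarith
  have e1 : (fun n : ℕ => 1 / q ^ (n + 1)) = fun n => q⁻¹ * q⁻¹ ^ n := by
    ext n
    rw [← pow_succ', inv_pow, one_div]
  have e2 : 1 / (q - 1) = q⁻¹ * (1 - q⁻¹)⁻¹ := by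
    rw [← mul_inv, mul_sub, mul_one, mul_inv_cancel₀ hq0, one_div]
  rwa [e1, e2]

theorem summable_digits (hq : 1 < q) (ha : ∀ n, a n ≤ 1) :
    Summable fun n : ℕ => (a n : ℝ) / q ^ (n + 1) := by
  refine Summable.of_nonneg_of_le (fun n => by positivity) (fun n => ?_)
    (hasSum_one_div_pow_succ hq).summable
  have : (a n : ℝ) ≤ 1 := by exact_mod_cast ha n
  gcongr

theorem tailValue_nonneg (hq : 1 < q) (k : ℕ) : 0 ≤ tailValue q a k :=
  tsum_nonneg fun n => by positivity

theorem tailValue_le (hq : 1 < q) (ha : ∀ n, a n ≤ 1) (k : ℕ) :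
    tailValue q a k ≤ 1 / (q - 1) := by
  rw [← (hasSum_one_div_pow_succ hq).tsum_eq]
  refine Summable.tsum_le_tsum (fun n => ?_) (summable_digits hq fun n => ha (k + n))
    (hasSum_one_div_pow_succ hq).summable
  have : (a (k + n) : ℝ) ≤ 1 := by exact_mod_cast ha _
  gcongr

theorem tailValue_eq_sum_add (hq : 1 < q) (ha : ∀ n, a n ≤ 1) (k i : ℕ) :
    tailValue q a k =
      ∑ j ∈ Finset.range i, (a (k + j) : ℝ) / q ^ (j + 1) + tailValue q a (k + i) / q ^ i := by
  rw [tailValue, ← (summable_digits hq fun n => ha (k + n)).sum_add_tsum_nat_add i, tailValue,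
    ← tsum_div_const]
  congr 2
  ext n
  rw [div_div, ← pow_add, add_assoc k, add_comm n i, add_right_comm n 1 i, add_comm n i]

theorem tailValue_succ (hq : 1 < q) (ha : ∀ n, a n ≤ 1) (k : ℕ) :
    tailValue q a k = (a k + tailValue q a (k + 1)) / q := by
  rw [tailValue_eq_sum_add hq ha k 1]
  simp [add_div]

theorem tailValue_zero_eq_iff (hq : 1 < q) {b : ℕ → ℕ} (ha : ∀ n, a n ≤ 1) (hb : ∀ n, b n ≤ 1)
    {m : ℕ} (h : ∀ j < m, a j = b j) :
    tailValue q a 0 = tailValue q b 0 ↔ tailValue q a m = tailValue q b m := by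
  rw [tailValue_eq_sum_add hq ha 0 m, tailValue_eq_sum_add hq hb 0 m,
    Finset.sum_congr rfl fun j hj => by rw [zero_add, h j (Finset.mem_range.1 hj)]]
  have : q ^ m ≠ 0 := by positivity
  simp [this]

/-- The value of the tail of `a` from `k` on, after complementing all digits if `c ≠ 0`. -/
def relValue (q : ℝ) (a : ℕ → ℕ) (c k : ℕ) : ℝ :=
  if c = 0 then tailValue q a k else 1 / (q - 1) - tailValue q a k

theorem relValue_nonneg (hq : 1 < q) (ha : ∀ n, a n ≤ 1) (c k : ℕ) : 0 ≤ relValue q a c k := by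
  have := tailValue_nonneg (a := a) hq k
  have := tailValue_le hq ha k
  unfold relValue
  split <;> linarith

theorem relValue_le (hq : 1 < q) (ha : ∀ n, a n ≤ 1) (c k : ℕ) :
    relValue q a c k ≤ 1 / (q - 1) := by
  have := tailValue_nonneg (a := a) hq k
  have := tailValue_le hq ha k
  unfold relValue
  split <;> linarith

theorem relValue_of_ne {c d : ℕ} (hc : c ≤ 1) (hd : d ≤ 1) (h : c ≠ d) (k : ℕ) :
    relValue q a c k = 1 / (q - 1) - relValue q a d k := by
  unfold relValue
  split_ifs <;> first | omega | ring

theorem relValue_succ (hq : 1 < q) (ha : ∀ n, a n ≤ 1) {c : ℕ} (hc : c ≤ 1) (k : ℕ) :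
    relValue q a c k = ((if a k = c then 0 else 1) + relValue q a c (k + 1)) / q := by
  have hq1 : q - 1 ≠ 0 := by linarith
  have hq0 : q ≠ 0 := by linarith
  unfold relValue
  rw [tailValue_succ hq ha k]
  have := ha k
  obtain h | h : a k = 0 ∨ a k = 1 := by omega
  all_goals obtain rfl | rfl : c = 0 ∨ c = 1 := by omega
  all_goals simp [h]
  all_goals field_simp
  all_goals ring

/-- The partial sums of the Thue–Morse series. -/
def morseSum (q : ℝ) (N : ℕ) : ℝ := ∑ i ∈ Finset.range N, (thueMorse (i + 1) : ℝ) / q ^ (i + 1)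

theorem morseSum_mono (hq : 1 < q) : Monotone (morseSum q) := by
  refine monotone_nat_of_le_succ fun n => ?_
  rw [morseSum, morseSum, Finset.sum_range_succ]
  have : 0 ≤ (thueMorse (n + 1) : ℝ) / q ^ (n + 1) := by positivity
  linarith

theorem morseSum_le_add (hq : 1 < q) (i N : ℕ) :
    morseSum q N ≤ morseSum q i + 1 / (q - 1) / q ^ i := by
  have ht : ∀ n, (fun n => thueMorse (n + 1)) n ≤ 1 := fun n => thueMorse_le_one _
  have h1 := tailValue_eq_sum_add hq ht 0 i
  have h2 := tailValue_eq_sum_add hq ht 0 N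
  simp only [zero_add] at h1 h2
  have h3 := tailValue_le hq ht i
  have h4 : 0 ≤ tailValue q (fun n => thueMorse (n + 1)) N / q ^ N :=
    div_nonneg (tailValue_nonneg hq N) (by positivity)
  have h5 : tailValue q (fun n => thueMorse (n + 1)) i / q ^ i ≤ 1 / (q - 1) / q ^ i := by
    gcongr
  unfold morseSum
  linarith

theorem relValue_eq_morseSum_add (hq : 1 < q) (ha : ∀ n, a n ≤ 1) {c : ℕ} (hc : c ≤ 1) (k i : ℕ)
    (h : ∀ j < i, (a (k + j) = c ↔ thueMorse (j + 1) = 0)) :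
    relValue q a c k = morseSum q i + relValue q a c (k + i) / q ^ i := by
  induction i with
  | zero => simp [morseSum]
  | succ i ih =>
    rw [ih fun j hj => h j (by omega), relValue_succ hq ha hc (k + i), morseSum, morseSum,
      Finset.sum_range_succ, add_assoc, ← add_assoc k i 1]
    have hi := h i (by omega)
    have := thueMorse_le_one (i + 1)
    obtain ht | ht : thueMorse (i + 1) = 0 ∨ thueMorse (i + 1) = 1 := by omega
    · rw [if_pos (hi.2 ht), ht, pow_succ', div_div]
      simp
    · rw [if_neg (fun h' => by have := hi.1 h'; omega), ht, pow_succ', div_div, add_div]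
      simp [add_assoc]

/-- `a` is the only expansion of its value in base `q`. -/
def IsUniqueExpansion (q : ℝ) (a : ℕ → ℕ) : Prop :=
  ∀ d : ℕ → ℕ, (∀ n, d n ≤ 1) → tailValue q d 0 = tailValue q a 0 → d = a

theorem exists_first_ne {a b : ℕ → ℕ} (h : a ≠ b) : ∃ m, a m ≠ b m ∧ ∀ j < m, a j = b j := by
  classical
  have hex : ∃ m, a m ≠ b m := Function.ne_iff.1 h
  exact ⟨Nat.find hex, Nat.find_spec hex, fun j hj => not_not.1 (Nat.find_min hex hj)⟩

theorem isUniqueExpansion_of_relValue_lt (hq : 1 < q) (ha : ∀ n, a n ≤ 1)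
    (h : ∀ k, relValue q a (a k) (k + 1) < 1) : IsUniqueExpansion q a := by
  intro d hd hda
  by_contra hne
  obtain ⟨m, hm, hlt⟩ := exists_first_ne hne
  rw [tailValue_zero_eq_iff hq hd ha hlt, tailValue_succ hq ha, tailValue_succ hq hd,
    div_left_inj' (by linarith)] at hda
  have h1 := h m
  have h2 := tailValue_nonneg (a := d) hq (m + 1)
  have h3 := tailValue_le hq hd (m + 1)
  have := ha m
  have := hd m
  obtain e | e : a m = 0 ∨ a m = 1 := by omega
  · have e' : d m = 1 := by omega
    simp only [relValue, e, e', if_true, Nat.cast_zero, Nat.cast_one] at *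
    linarith
  · have e' : d m = 0 := by omega
    simp only [relValue, e, e', one_ne_zero, if_false, Nat.cast_zero, Nat.cast_one] at *
    linarith

/-- The remainders of the greedy algorithm in base `q`. -/
def greedyRem (q y : ℝ) : ℕ → ℝ
  | 0 => y
  | n + 1 => if 1 ≤ q * greedyRem q y n then q * greedyRem q y n - 1 else q * greedyRem q y n

theorem exists_expansion (hq : 1 < q) (hq2 : q ≤ 2) {y : ℝ} (hy : y ∈ Set.Icc 0 (1 / (q - 1))) :
    ∃ d : ℕ → ℕ, (∀ n, d n ≤ 1) ∧ tailValue q d 0 = y := by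
  have hq1 : 0 < q - 1 := by linarith
  have hC : 1 ≤ 1 / (q - 1) := by rw [le_div_iff₀ hq1]; linarith
  have hCq : q * (1 / (q - 1)) - 1 = 1 / (q - 1) := by field_simp; ring
  have hr : ∀ n, greedyRem q y n ∈ Set.Icc 0 (1 / (q - 1)) := by
    intro n
    induction n with
    | zero => exact hy
    | succ n ih =>
      have h1 : 0 ≤ q * greedyRem q y n := mul_nonneg (by linarith) ih.1
      have h2 : q * greedyRem q y n ≤ q * (1 / (q - 1)) :=
        mul_le_mul_of_nonneg_left ih.2 (by linarith)
      rw [greedyRem]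
      split_ifs with hif
      · exact ⟨by linarith, by linarith⟩
      · exact ⟨h1, by linarith⟩
  let d : ℕ → ℕ := fun n => if 1 ≤ q * greedyRem q y n then 1 else 0
  have hd : ∀ n, d n ≤ 1 := fun n => by
    simp only [d]; split <;> omega
  have hstep : ∀ n, greedyRem q y (n + 1) = q * greedyRem q y n - d n := by
    intro n
    simp only [d]
    rw [greedyRem]
    split <;> simp
  have hsum : ∀ n, y = ∑ j ∈ Finset.range n, (d j : ℝ) / q ^ (j + 1) +
      greedyRem q y n / q ^ n := by
    intro n
    induction n with
    | zero => simp [greedyRem]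
    | succ n ih =>
      have hq0 : q ≠ 0 := by linarith
      rw [Finset.sum_range_succ, hstep, add_assoc, ← add_div, add_sub_cancel, pow_succ',
        mul_div_mul_left _ _ hq0]
      exact ih
  refine ⟨d, hd, ?_⟩
  have hlim : Filter.Tendsto (fun n : ℕ => 1 / (q - 1) * q⁻¹ ^ n) Filter.atTop (nhds 0) := by
    simpa using (tendsto_pow_atTop_nhds_zero_of_lt_one (r := q⁻¹) (by positivity)
      (inv_lt_one_of_one_lt₀ hq)).const_mul (1 / (q - 1))
  have habs : ∀ n : ℕ, |tailValue q d 0 - y| ≤ 1 / (q - 1) * q⁻¹ ^ n := by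
    intro n
    have h1 := tailValue_eq_sum_add hq hd 0 n
    simp only [zero_add] at h1
    have h2 := hsum n
    have h3 : tailValue q d 0 - y = (tailValue q d n - greedyRem q y n) / q ^ n := by
      rw [sub_div]; linarith
    have hqn : 0 < q ^ n := by positivity
    rw [h3, abs_div, abs_of_pos hqn, inv_pow, ← div_eq_mul_inv]
    refine div_le_div_of_nonneg_right ?_ hqn.le
    have h4 := hr n
    have h5 := tailValue_nonneg (a := d) hq n
    have h6 := tailValue_le hq hd n
    rw [abs_le]
    exact ⟨by linarith [h4.2], by linarith [h4.1]⟩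
  have := ge_of_tendsto' hlim habs
  exact sub_eq_zero.1 (abs_nonpos_iff.1 this)

/-- The first `k` digits of `a`, followed by `d`. -/
def splice (a : ℕ → ℕ) (k : ℕ) (d : ℕ → ℕ) : ℕ → ℕ := fun i => if i < k then a i else d (i - k)

theorem splice_of_lt {d : ℕ → ℕ} {k i : ℕ} (h : i < k) : splice a k d i = a i := if_pos h

theorem splice_add {d : ℕ → ℕ} (k i : ℕ) : splice a k d (k + i) = d i := by
  simp [splice]

theorem splice_self {d : ℕ → ℕ} (k : ℕ) : splice a k d k = d 0 := splice_add k 0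

theorem splice_le_one {d : ℕ → ℕ} (ha : ∀ n, a n ≤ 1) (hd : ∀ n, d n ≤ 1) (k n : ℕ) :
    splice a k d n ≤ 1 := by
  unfold splice
  split
  · exact ha _
  · exact hd _

theorem tailValue_splice {d : ℕ → ℕ} (k i : ℕ) :
    tailValue q (splice a k d) (k + i) = tailValue q d i := by
  simp only [tailValue, add_assoc, splice_add]

theorem IsUniqueExpansion.relValue_lt (hq : 1 < q) (hq2 : q ≤ 2) (ha : ∀ n, a n ≤ 1)
    (h : IsUniqueExpansion q a) (k : ℕ) : relValue q a (a k) (k + 1) < 1 := by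
  by_contra hcon
  rw [not_lt] at hcon
  have h2 := tailValue_nonneg (a := a) hq (k + 1)
  have h3 := tailValue_le hq ha (k + 1)
  have hak := ha k
  have hy : (a k + tailValue q a (k + 1) - (1 - a k : ℕ) : ℝ) ∈ Set.Icc 0 (1 / (q - 1)) := by
    obtain e | e : a k = 0 ∨ a k = 1 := by omega
    · simp only [relValue, e, if_true] at hcon
      simp only [e, Nat.cast_zero, tsub_zero, Nat.cast_one]
      exact ⟨by linarith, by linarith⟩
    · simp only [relValue, e, one_ne_zero, if_false] at hcon
      simp only [e, Nat.cast_zero, tsub_self, Nat.cast_one]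
      exact ⟨by linarith, by linarith⟩
  obtain ⟨d, hd, hdy⟩ := exists_expansion hq hq2 hy
  have hf : ∀ n, splice (fun _ => 1 - a k) 1 d n ≤ 1 :=
    splice_le_one (fun _ => by omega) hd 1
  set e := splice a k (splice (fun _ => 1 - a k) 1 d) with he
  have hele : ∀ n, e n ≤ 1 := splice_le_one ha hf k
  have hek : e k = 1 - a k := by rw [he, splice_self, splice_of_lt one_pos]
  have hval : tailValue q e 0 = tailValue q a 0 := by
    rw [tailValue_zero_eq_iff hq hele ha fun j hj => splice_of_lt hj, tailValue_succ hq hele,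
      tailValue_succ hq ha, hek, he, tailValue_splice, tailValue_splice (i := 0) (k := 1), hdy]
    ring
  have := congrFun (h e hele hval) k
  omega

theorem belowThueMorse_of_relValue_lt (hq : 1 < q) (ha : ∀ n, a n ≤ 1)
    (h : ∀ k, relValue q a (a k) (k + 1) < 1) {N : ℕ} (hN : 1 ≤ morseSum q N) (k : ℕ) :
    BelowThueMorse a N k := by
  classical
  have hmatch : ∀ i, (∀ j < i, (a (k + 1 + j) = a k ↔ thueMorse (j + 1) = 0)) →
      relValue q a (a k) (k + 1) = morseSum q i + relValue q a (a k) (k + 1 + i) / q ^ i :=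
    fun i => relValue_eq_morseSum_add hq ha (ha k) (k + 1) i
  have hk := h k
  have hex : ∃ i, i < N ∧ ¬ (a (k + 1 + i) = a k ↔ thueMorse (i + 1) = 0) := by
    by_contra! hcon
    rw [hmatch N hcon] at hk
    have : 0 ≤ relValue q a (a k) (k + 1 + N) / q ^ N :=
      div_nonneg (relValue_nonneg hq ha _ _) (by positivity)
    linarith
  set i := Nat.find hex with hi
  obtain ⟨hiN, hne⟩ := Nat.find_spec hex
  rw [← hi] at hiN hne
  have hlt : ∀ j < i, (a (k + 1 + j) = a k ↔ thueMorse (j + 1) = 0) := by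
    intro j hj
    by_contra hcon
    exact Nat.find_min hex hj ⟨by omega, hcon⟩
  have ht := thueMorse_le_one (i + 1)
  obtain ht | ht : thueMorse (i + 1) = 0 ∨ thueMorse (i + 1) = 1 := by omega
  · exfalso
    have hnea : a (k + 1 + i) ≠ a k := by tauto
    have h1 := h (k + 1 + i)
    have h2 := morseSum_le_add hq (i + 1) N
    rw [hmatch i hlt, relValue_succ hq ha (ha k), if_neg hnea,
      relValue_of_ne (ha k) (ha (k + 1 + i)) hnea.symm, div_div, ← pow_succ'] at hk
    have h3 : morseSum q (i + 1) = morseSum q i := by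
      simp [morseSum, Finset.sum_range_succ, ht]
    have h4 : 1 / (q - 1) / q ^ (i + 1) ≤
        (1 + (1 / (q - 1) - relValue q a (a (k + 1 + i)) (k + 1 + i + 1))) / q ^ (i + 1) := by
      gcongr
      linarith
    linarith
  · refine ⟨i + 1, by omega, by omega, ht, ?_, fun j hj => ?_⟩
    · rw [show k + (i + 1) = k + 1 + i by ring]
      by_contra hcon
      exact hne ⟨fun h => absurd h hcon, fun h => by omega⟩
    · rcases j with _ | j
      · simp [thueMorse_zero]
      · rw [show k + (j + 1) = k + 1 + j by ring]
        exact hlt j (by omega)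

theorem relValue_lt_of_belowThueMorse (hq : 1 < q) (ha : ∀ n, a n ≤ 1) {N : ℕ}
    (h : ∀ k, BelowThueMorse a N k) (hN : morseSum q N < 1) (k : ℕ) :
    relValue q a (a k) (k + 1) < 1 := by
  have hstep : ∀ k, ∃ i, 1 ≤ i ∧ relValue q a (a k) (k + 1) ≤
      morseSum q N - 1 / q ^ i + relValue q a (a (k + i)) (k + i + 1) / q ^ i := by
    intro k
    obtain ⟨i, hi1, hiN, hti, hai, hij⟩ := h k
    obtain ⟨i, rfl⟩ := Nat.exists_eq_add_of_le' hi1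
    refine ⟨i + 1, hi1, ?_⟩
    have h1 := morseSum_mono hq hiN
    have h2 : morseSum q (i + 1) = morseSum q i + 1 / q ^ (i + 1) := by
      simp [morseSum, Finset.sum_range_succ, hti]
    rw [relValue_eq_morseSum_add hq ha (ha k) (k + 1) i fun j hj => by
        rw [show k + 1 + j = k + (j + 1) by ring]; exact hij (j + 1) (by omega),
      relValue_succ hq ha (ha k), show k + 1 + i = k + (i + 1) by ring, if_pos hai, hai, zero_add,
      div_div, ← pow_succ']
    linarith
  have hC : 0 < 1 / (q - 1) := one_div_pos.2 (by linarith)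
  have hbound : ∀ r k : ℕ, relValue q a (a k) (k + 1) ≤ 1 + 1 / (q - 1) * q⁻¹ ^ r := by
    intro r
    induction r with
    | zero =>
      intro k
      have := relValue_le hq ha (a k) (k + 1)
      rw [pow_zero]
      linarith
    | succ r ih =>
      intro k
      obtain ⟨i, hi, hk⟩ := hstep k
      have hqi : 0 < q ^ i := by positivity
      have h1 := div_le_div_of_nonneg_right (ih (k + i)) hqi.le
      have h2 : 1 / q ^ i ≤ q⁻¹ := by
        rw [one_div]
        exact inv_anti₀ (by linarith) (by simpa using pow_le_pow_right₀ hq.le hi)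
      have h3 : (1 + 1 / (q - 1) * q⁻¹ ^ r) / q ^ i =
          1 / q ^ i + 1 / (q - 1) * q⁻¹ ^ r * (1 / q ^ i) := by ring
      have h4 : 1 / (q - 1) * q⁻¹ ^ r * (1 / q ^ i) ≤ 1 / (q - 1) * q⁻¹ ^ r * q⁻¹ := by
        gcongr
      rw [pow_succ, ← mul_assoc]
      linarith
  have hle : ∀ k, relValue q a (a k) (k + 1) ≤ 1 := by
    intro k
    have hlim : Filter.Tendsto (fun r : ℕ => 1 + 1 / (q - 1) * q⁻¹ ^ r) Filter.atTop (nhds 1) := by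
      simpa using ((tendsto_pow_atTop_nhds_zero_of_lt_one (r := q⁻¹) (by positivity)
        (inv_lt_one_of_one_lt₀ hq)).const_mul (1 / (q - 1))).const_add 1
    exact ge_of_tendsto' hlim fun r => hbound r k
  obtain ⟨i, -, hk⟩ := hstep k
  have := div_le_div_of_nonneg_right (hle (k + i)) (by positivity : 0 ≤ q ^ i)
  linarith

theorem tailValue_of_eventuallyPeriodic (hq : 1 < q) (ha : ∀ n, a n ≤ 1) {N p : ℕ}
    (h : EventuallyPeriodic a N p) :
    (1 - q⁻¹ ^ p) * tailValue q a 0 =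
      (1 - q⁻¹ ^ p) * ∑ i ∈ Finset.range N, (a i : ℝ) * q⁻¹ ^ (i + 1) +
        q⁻¹ ^ N * ∑ i ∈ Finset.range p, (a (N + i) : ℝ) * q⁻¹ ^ (i + 1) := by
  have h1 := tailValue_eq_sum_add hq ha 0 N
  have h2 := tailValue_eq_sum_add hq ha N p
  have h3 : tailValue q a (N + p) = tailValue q a N := by
    unfold tailValue
    congr 1
    ext n
    rw [add_right_comm, h.2 (N + n) (by omega)]
  rw [h3] at h2
  simp only [zero_add, div_eq_mul_inv, ← inv_pow] at h1 h2
  rw [h1]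
  linear_combination q⁻¹ ^ N * h2

theorem isAlgebraic_of_eventuallyPeriodic (hq : 1 < q) {b : ℕ → ℕ} (ha : ∀ n, a n ≤ 1)
    (hb : ∀ n, b n ≤ 1) (h : 1 + tailValue q a 0 = tailValue q b 0) {N p N' p' : ℕ}
    (hpa : EventuallyPeriodic a N p) (hpb : EventuallyPeriodic b N' p') : IsAlgebraic ℚ q := by
  have hpa' := hpa.mono (le_max_left N N') p' hpb.1
  have hpb' := hpb.mono (le_max_right N N') p hpa.1
  rw [mul_comm p'] at hpb'
  generalize max N N' = M at hpa' hpb'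
  generalize p * p' = r at hpa' hpb'
  have e1 := tailValue_of_eventuallyPeriodic hq ha hpa'
  have e2 := tailValue_of_eventuallyPeriodic hq hb hpb'
  let P : Polynomial ℚ :=
    (1 - Polynomial.X ^ r) *
      (1 + ∑ i ∈ Finset.range M, Polynomial.C (a i - b i : ℚ) * Polynomial.X ^ (i + 1)) +
    Polynomial.X ^ M *
      ∑ i ∈ Finset.range r, Polynomial.C (a (M + i) - b (M + i) : ℚ) * Polynomial.X ^ (i + 1)
  have hP : P ≠ 0 := by
    intro h0
    have := congrArg (Polynomial.eval 0) h0
    simp [P, Polynomial.eval_finsetSum, hpa'.1.ne'] at this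
  have hroot : Polynomial.aeval q⁻¹ P = 0 := by
    simp only [P, map_add, map_mul, map_sub, map_one, map_pow, Polynomial.aeval_X, map_sum,
      map_natCast, sub_mul, Finset.sum_sub_distrib]
    linear_combination (1 - q⁻¹ ^ r) * h - e1 + e2
  have : IsAlgebraic ℚ q⁻¹ := ⟨P, hP, hroot⟩
  simpa using this.inv

theorem exists_eventuallyPeriodic_of_isUniqueExpansion (hq : 1 < q) (hq2 : q ≤ 2)
    (ha : ∀ n, a n ≤ 1) (h : IsUniqueExpansion q a) {n : ℕ} (hn : 1 ≤ morseSum q (2 ^ n)) :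
    ∃ N p, EventuallyPeriodic a N p :=
  eventuallyPeriodic_of_belowThueMorse ha n
    (belowThueMorse_of_relValue_lt hq ha (h.relValue_lt hq hq2 ha) hn)

theorem isUniqueExpansion_shift (hq : 1 < q) {b : ℕ → ℕ} (ha : ∀ n, a n ≤ 1) {m : ℕ}
    (hab : a m ≠ b m)
    (honly : ∀ d : ℕ → ℕ, (∀ n, d n ≤ 1) → tailValue q d 0 = tailValue q a 0 → d = a ∨ d = b) :
    IsUniqueExpansion q fun i => a (m + 1 + i) := by
  intro d hd hval
  have hle := splice_le_one ha hd (m + 1)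
  have h0 : tailValue q (fun i => a (m + 1 + i)) 0 = tailValue q a (m + 1) := by
    simp [tailValue]
  have hval' : tailValue q (splice a (m + 1) d) 0 = tailValue q a 0 := by
    rw [tailValue_zero_eq_iff hq hle ha fun j hj => splice_of_lt hj, ← h0, ← hval]
    exact tailValue_splice (m + 1) 0
  rcases honly _ hle hval' with h | h
  · ext i
    rw [← h, splice_add]
  · have := congrFun h m
    rw [splice_of_lt (Nat.lt_succ_self m)] at this
    exact absurd this hab

theorem isAlgebraic_of_two_expansions (hq : 1 < q) (hq2 : q ≤ 2) {b : ℕ → ℕ}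
    (ha : ∀ n, a n ≤ 1) (hb : ∀ n, b n ≤ 1) (hne : a ≠ b)
    (hval : tailValue q a 0 = tailValue q b 0)
    (honly : ∀ d : ℕ → ℕ, (∀ n, d n ≤ 1) → tailValue q d 0 = tailValue q a 0 → d = a ∨ d = b)
    {n : ℕ} (hn : 1 ≤ morseSum q (2 ^ n)) : IsAlgebraic ℚ q := by
  obtain ⟨m, hm, hlt⟩ := exists_first_ne hne
  obtain ⟨N, p, hpa⟩ := exists_eventuallyPeriodic_of_isUniqueExpansion hq hq2
    (fun i => ha (m + 1 + i)) (isUniqueExpansion_shift hq ha hm honly) hn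
  obtain ⟨N', p', hpb⟩ := exists_eventuallyPeriodic_of_isUniqueExpansion hq hq2
    (fun i => hb (m + 1 + i)) (isUniqueExpansion_shift hq hb hm.symm
      fun d hd h => (honly d hd (h.trans hval.symm)).symm) hn
  have hshift : ∀ c : ℕ → ℕ, tailValue q (fun i => c (m + 1 + i)) 0 = tailValue q c (m + 1) := by
    intro c
    simp [tailValue]
  rw [tailValue_zero_eq_iff hq ha hb hlt, tailValue_succ hq ha, tailValue_succ hq hb,
    div_left_inj' (by linarith)] at hval
  have := ha m
  have := hb m
  obtain ⟨e1, e2⟩ | ⟨e1, e2⟩ : a m = 0 ∧ b m = 1 ∨ a m = 1 ∧ b m = 0 := by omega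
  · refine isAlgebraic_of_eventuallyPeriodic hq (fun i => hb (m + 1 + i))
      (fun i => ha (m + 1 + i)) ?_ hpb hpa
    rw [hshift, hshift]
    simp only [e1, e2, Nat.cast_zero, Nat.cast_one] at hval
    linarith
  · refine isAlgebraic_of_eventuallyPeriodic hq (fun i => ha (m + 1 + i))
      (fun i => hb (m + 1 + i)) ?_ hpa hpb
    rw [hshift, hshift]
    simp only [e1, e2, Nat.cast_zero, Nat.cast_one] at hval
    linarith

theorem isAlgebraic_of_mem_B_two (hq : q ∈ B 2) (hq1 : 1 < q) {n : ℕ}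
    (hn : 1 ≤ morseSum q (2 ^ n)) : IsAlgebraic ℚ q := by
  obtain ⟨hG, x, -, hcard⟩ := hq
  obtain ⟨⟨a, ha⟩, ⟨b, hb⟩, hne, huniv⟩ := Cardinal.mk_eq_two_iff.1 hcard
  have ha' := isExpansion_iff.1 ha
  have hb' := isExpansion_iff.1 hb
  refine isAlgebraic_of_two_expansions hq1 hG.2.le ha'.1 hb'.1 (fun h => hne (Subtype.ext h))
    (ha'.2.symm.trans hb'.2) (fun d hd hda => ?_) hn
  have hmem : d ∈ expansionsOf q x := isExpansion_iff.2 ⟨hd, ha'.2.trans hda.symm⟩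
  have := huniv.symm ▸ Set.mem_univ (⟨d, hmem⟩ : expansionsOf q x)
  simpa using this

/-- Prepending `1` to `a` and `0` to `b` produces the two expansions of one number. -/
theorem mem_B_two_of_isUniqueExpansion (hG : (1 + Real.sqrt 5) / 2 < q) (hq : 1 < q) (hq2 : q < 2)
    {b : ℕ → ℕ} (ha : ∀ n, a n ≤ 1) (hb : ∀ n, b n ≤ 1)
    (hua : IsUniqueExpansion q a) (hub : IsUniqueExpansion q b)
    (hab : 1 + tailValue q a 0 = tailValue q b 0) : q ∈ B 2 := by
  set A := splice (fun _ => 1) 1 a with hA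
  set E := splice (fun _ => 0) 1 b with hE
  have hAle : ∀ n, A n ≤ 1 := splice_le_one (fun _ => le_rfl) ha 1
  have hEle : ∀ n, E n ≤ 1 := splice_le_one (fun _ => Nat.zero_le _) hb 1
  have hA0 : A 0 = 1 := splice_of_lt one_pos
  have hE0 : E 0 = 0 := splice_of_lt one_pos
  have hA1 : tailValue q A 1 = tailValue q a 0 := tailValue_splice 1 0
  have hE1 : tailValue q E 1 = tailValue q b 0 := tailValue_splice 1 0
  have hAE : tailValue q A 0 = tailValue q E 0 := by
    rw [tailValue_succ hq hAle, tailValue_succ hq hEle, hA0, hE0, zero_add, hA1, hE1, ← hab]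
    simp
  have hne : A ≠ E := fun h => by
    have := congrFun h 0
    omega
  have hset : expansionsOf q (tailValue q A 0) = {A, E} := by
    ext d
    simp only [expansionsOf, Set.mem_ofPred_eq, isExpansion_iff, Set.mem_insert_iff,
      Set.mem_singleton_iff]
    constructor
    · rintro ⟨hd, hval⟩
      have hd' : ∀ n, (fun i => d (1 + i)) n ≤ 1 := fun n => hd _
      have hsh : tailValue q (fun i => d (1 + i)) 0 = tailValue q d 1 := by
        simp [tailValue]
      have hsplit : d = splice (fun _ => d 0) 1 fun i => d (1 + i) := by
        ext i
        rcases i with _ | i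
        · simp [splice]
        · simp [splice, add_comm]
      have hd0 := hd 0
      obtain e | e : d 0 = 0 ∨ d 0 = 1 := by omega
      · right
        rw [hAE, tailValue_succ hq hEle, tailValue_succ hq hd, div_left_inj' (by linarith), e, hE0,
          add_right_inj, zero_add, hE1, ← hsh] at hval
        rw [hsplit, hub _ hd' hval.symm, e]
      · left
        rw [tailValue_succ hq hAle, tailValue_succ hq hd, div_left_inj' (by linarith), e, hA0,
          add_right_inj, zero_add, hA1, ← hsh] at hval
        rw [hsplit, hua _ hd' hval.symm, e]
    · rintro (rfl | rfl)
      · exact ⟨hAle, rfl⟩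
      · exact ⟨hEle, hAE⟩
  refine ⟨⟨hG, hq2⟩, tailValue q A 0, ⟨tailValue_nonneg hq 0, tailValue_le hq hAle 0⟩, ?_⟩
  rw [hset]
  refine Cardinal.mk_eq_two_iff.2 ⟨⟨A, by simp⟩, ⟨E, by simp⟩, fun h => hne (congrArg Subtype.val h),
    ?_⟩
  ext ⟨d, hd⟩
  simpa using hd

theorem morseSum_two_pow_lt (hq : 1 < q) (n : ℕ) :
    morseSum q (2 ^ n) < morseSum q (2 ^ (n + 1)) := by
  have hpos : 0 < 2 ^ n := by positivity
  obtain ⟨M, hM⟩ : ∃ M, 2 ^ (n + 1) = M + 1 := ⟨2 ^ (n + 1) - 1, by rw [pow_succ]; omega⟩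
  have h1 : morseSum q (2 ^ (n + 1)) = morseSum q M + 1 / q ^ (M + 1) := by
    have := thueMorse_two_pow (n + 1)
    rw [hM] at this ⊢
    simp [morseSum, Finset.sum_range_succ, this]
  have h2 : morseSum q (2 ^ n) ≤ morseSum q M :=
    morseSum_mono hq (by rw [pow_succ] at hM; omega)
  have : 0 < 1 / q ^ (M + 1) := by positivity
  linarith

theorem mem_B_two_of_morseSum_eq_one (hq : 1 < q) (hq2 : q < 2) {n : ℕ} (hn : 2 ≤ n)
    (h : morseSum q (2 ^ n) = 1) : q ∈ B 2 := by
  obtain ⟨m, rfl⟩ := Nat.exists_eq_add_of_le' (by omega : 1 ≤ n)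
  have hlt := morseSum_two_pow_lt hq m
  rw [h] at hlt
  have hG : (1 + Real.sqrt 5) / 2 < q := by
    have h1 : morseSum q (2 ^ 1) ≤ morseSum q (2 ^ m) :=
      morseSum_mono hq (Nat.pow_le_pow_right two_pos (by omega : 1 ≤ m))
    have h2 := thueMorse_two
    have h3 : morseSum q (2 ^ 1) = 1 / q + 1 / q ^ 2 := by
      simp [morseSum, Finset.sum_range_succ, thueMorse_one, h2]
    have h4 : 1 / q + 1 / q ^ 2 < 1 := h3 ▸ h1.trans_lt hlt
    have h5 : q + 1 < q ^ 2 := by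
      have hq0 : 0 < q := by linarith
      have : (1 / q + 1 / q ^ 2) * q ^ 2 < 1 * q ^ 2 := by gcongr
      have e : (1 / q + 1 / q ^ 2) * q ^ 2 = q + 1 := by field_simp
      linarith
    have : Real.sqrt 5 < 2 * q - 1 := by
      rw [Real.sqrt_lt' (by linarith)]
      nlinarith
    linarith
  have ha : ∀ k, (fun i => morseWord m (i + 1)) k ≤ 1 := fun k => morseWord_le_one _ _
  have hb : ∀ k, (fun i => if i < 2 ^ (m + 1) then 1 else morseWord m (i + 1)) k ≤ 1 := by
    intro k
    dsimp only
    split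
    · exact le_rfl
    · exact morseWord_le_one _ _
  have hwa : ∀ k, BelowThueMorse (fun i => morseWord m (i + 1)) (2 ^ m) k := by
    intro k
    obtain ⟨i, hi1, hiN, hti, hai, hij⟩ := belowThueMorse_morseWord m (k + 1) (by omega)
    refine ⟨i, hi1, hiN, hti, ?_, fun j hj => ?_⟩
    · dsimp only
      rw [← hai, add_right_comm]
    · dsimp only
      rw [← hij j hj, add_right_comm]
  have hwb : ∀ k, BelowThueMorse
      (fun i => if i < 2 ^ (m + 1) then 1 else morseWord m (i + 1)) (2 ^ m) k := by
    intro k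
    by_cases hk : k < 2 ^ (m + 1)
    · refine ⟨1, le_rfl, Nat.one_le_two_pow, thueMorse_one, ?_, fun j hj => ?_⟩
      · dsimp only
        rw [if_pos hk]
        split_ifs with hk'
        · rfl
        · rw [show k + 1 = 2 ^ (m + 1) by omega]
          exact morseWord_two_pow_add_one m (by omega)
      · obtain rfl : j = 0 := by omega
        simp [thueMorse_zero]
    · have hsame : ∀ j, (if k + j < 2 ^ (m + 1) then 1 else morseWord m (k + j + 1)) =
          morseWord m (k + j + 1) := fun j => if_neg (by omega)
      have hsame0 : (if k < 2 ^ (m + 1) then 1 else morseWord m (k + 1)) =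
          morseWord m (k + 1) := if_neg hk
      have := hwa k
      unfold BelowThueMorse at this ⊢
      simpa only [hsame, hsame0] using this
  refine mem_B_two_of_isUniqueExpansion hG hq hq2 ha hb
    (isUniqueExpansion_of_relValue_lt hq ha (relValue_lt_of_belowThueMorse hq ha hwa hlt))
    (isUniqueExpansion_of_relValue_lt hq hb (relValue_lt_of_belowThueMorse hq hb hwb hlt)) ?_
  rw [tailValue_eq_sum_add hq ha 0 (2 ^ (m + 1)), tailValue_eq_sum_add hq hb 0 (2 ^ (m + 1)), ← h,
    morseSum, ← add_assoc, ← Finset.sum_add_distrib]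
  congr 1
  · refine Finset.sum_congr rfl fun j hj => ?_
    have hj' := Finset.mem_range.1 hj
    have := morseWord_add_thueMorse m (j + 1) (by omega)
    simp only [zero_add, if_pos hj']
    rw [← add_div]
    congr 1
    rw [add_comm] at this
    exact_mod_cast this
  · congr 1
    unfold tailValue
    congr 1
    ext j
    dsimp only
    rw [if_neg (by omega)]

end

theorem morseSum_strictAnti {N : ℕ} (hN : 0 < N) {p q : ℝ} (hp : 0 < p) (hpq : p < q) :
    morseSum q N < morseSum p N := by
  refine Finset.sum_lt_sum (fun i _ => ?_) ⟨0, Finset.mem_range.2 hN, ?_⟩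
  · gcongr
  · simp only [zero_add, thueMorse_one, pow_one]
    gcongr

theorem continuousOn_morseSum {s : Set ℝ} (hs : ∀ x ∈ s, 0 < x) (N : ℕ) :
    ContinuousOn (fun q => morseSum q N) s := by
  unfold morseSum
  refine continuousOn_finsetSum _ fun i _ => ?_
  refine continuousOn_const.div (continuousOn_pow _) fun x hx => ?_
  have := hs x hx
  positivity

theorem summable_thueMorse {q : ℝ} (hq : 1 < q) :
    Summable fun n : ℕ => (thueMorse (n + 1) : ℝ) / q ^ (n + 1) :=
  summable_digits (a := fun n => thueMorse (n + 1)) hq fun _ => thueMorse_le_one _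

theorem morseSum_two_pow_lt_tsum {q : ℝ} (hq : 1 < q) (n : ℕ) :
    morseSum q (2 ^ n) < ∑' n : ℕ, (thueMorse (n + 1) : ℝ) / q ^ (n + 1) :=
  (morseSum_two_pow_lt hq n).trans_le
    ((summable_thueMorse hq).sum_le_tsum _ fun _ _ => by positivity)

theorem eventually_one_lt_morseSum {q r : ℝ} (hq : 1 < q) (hqr : q < r)
    (hr : ∑' n : ℕ, (thueMorse (n + 1) : ℝ) / r ^ (n + 1) = 1) :
    ∀ᶠ n in Filter.atTop, 1 < morseSum q (2 ^ n) := by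
  have hlt : 1 < ∑' n : ℕ, (thueMorse (n + 1) : ℝ) / q ^ (n + 1) := by
    rw [← hr]
    refine Summable.tsum_lt_tsum (i := 0) (fun i => ?_) ?_ (summable_thueMorse (hq.trans hqr))
      (summable_thueMorse hq)
    · gcongr
    · simp only [zero_add, thueMorse_one, pow_one]
      gcongr
  exact ((summable_thueMorse hq).hasSum.tendsto_sum_nat.comp
    (tendsto_pow_atTop_atTop_of_one_lt one_lt_two)).eventually (lt_mem_nhds hlt)

theorem stmt4 (qf qKL : ℝ)
    (hqf : qf ∈ Set.Ioo (1:ℝ) 2) (hqfeq : qf ^ 3 = 2 * qf ^ 2 - qf + 1)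
    (hqKL : qKL ∈ Set.Ioo (1:ℝ) 2)
    (hqKLeq : ∑' n : ℕ, (thueMorse (n + 1) : ℝ) / qKL ^ (n + 1) = 1) :
    (B 2 ∩ Set.Ioo qf qKL).Countable ∧ (B 2 ∩ Set.Ioo qf qKL).Infinite ∧
      ∃ Q : ℕ → ℝ,
        (∀ n, 2 ≤ n → Q n ∈ Set.Ioo (1:ℝ) 2 ∧
          (∑ i ∈ Finset.range (2 ^ n), (thueMorse (i + 1) : ℝ) / Q n ^ (i + 1)) = 1 ∧
          Q n ∈ B 2) ∧
        StrictMonoOn Q {n : ℕ | 2 ≤ n} ∧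
        Filter.Tendsto Q Filter.atTop (nhds qKL) := by
  have hq1 : 1 < qf := hqf.1
  have hpos : ∀ n, 0 < 2 ^ n := fun n => by positivity
  have hf4 : morseSum qf (2 ^ 2) = 1 := by
    have h2 := thueMorse_two
    have h3 : thueMorse 3 = 0 := by
      simpa [thueMorse_one] using thueMorse_two_mul_add_one 1
    have h4 : thueMorse 4 = 1 := by simpa using thueMorse_two_pow 2
    have e : morseSum qf (2 ^ 2) = 1 / qf + 1 / qf ^ 2 + 1 / qf ^ 4 := by
      simp [morseSum, Finset.sum_range_succ, thueMorse_one, h2, h3, h4]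
    rw [e]
    field_simp
    linear_combination (-(qf + 1)) * hqfeq
  have hKL : ∀ n, morseSum qKL (2 ^ n) < 1 := fun n => by
    rw [← hqKLeq]
    exact morseSum_two_pow_lt_tsum hqKL.1 n
  have hroot : ∀ {p q : ℝ} (n : ℕ), 0 < q → morseSum q (2 ^ n) < morseSum p (2 ^ n) →
      p < q := by
    intro p q n hq h
    by_contra hcon
    rcases (not_lt.1 hcon).lt_or_eq with h' | rfl
    · exact lt_asymm h (morseSum_strictAnti (hpos n) hq h')
    · exact lt_irrefl _ h
  have hfKL : qf < qKL := hroot 2 (by linarith [hqKL.1]) (by rw [hf4]; exact hKL 2)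
  have hex : ∀ n, 2 ≤ n → ∃ q ∈ Set.Icc qf qKL, morseSum q (2 ^ n) = 1 := by
    intro n hn
    refine intermediate_value_Icc' hfKL.le
      (continuousOn_morseSum (fun x hx => by linarith [hx.1]) _) ⟨(hKL n).le, ?_⟩
    rw [← hf4]
    exact morseSum_mono hq1 (Nat.pow_le_pow_right two_pos hn)
  choose! Q hQmem hQ using hex
  have hQ1 : ∀ n, 2 ≤ n → 1 < Q n := fun n hn => hq1.trans_le (hQmem n hn).1
  have hQKL : ∀ n, 2 ≤ n → Q n < qKL := fun n hn =>
    hroot n (by linarith [hqKL.1]) (by rw [hQ n hn]; exact hKL n)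
  have hQB : ∀ n, 2 ≤ n → Q n ∈ B 2 := fun n hn =>
    mem_B_two_of_morseSum_eq_one (hQ1 n hn) ((hQKL n hn).trans hqKL.2) hn (hQ n hn)
  have hQsucc : ∀ n, 2 ≤ n → Q n < Q (n + 1) := fun n hn => by
    have h1 := hQ1 (n + 1) (by omega)
    refine hroot n (by linarith) ?_
    rw [hQ n hn, ← hQ (n + 1) (by omega)]
    exact morseSum_two_pow_lt h1 n
  have hmono : StrictMono fun n => Q (n + 2) :=
    strictMono_nat_of_lt_succ fun n => by
      have := hQsucc (n + 2) (by omega)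
      rwa [add_right_comm] at this
  refine ⟨?_, ?_, Q, fun n hn => ⟨⟨hQ1 n hn, (hQKL n hn).trans hqKL.2⟩, hQ n hn, hQB n hn⟩, ?_, ?_⟩
  · refine (Algebraic.countable ℚ ℝ).mono ?_
    rintro q ⟨hqB, hqmem⟩
    have hq : 1 < q := hq1.trans hqmem.1
    obtain ⟨n, hn⟩ := (eventually_one_lt_morseSum hq hqmem.2 hqKLeq).exists
    exact isAlgebraic_of_mem_B_two hqB hq hn.le
  · refine Set.infinite_of_injective_forall_mem
      (hmono.injective.comp (add_left_injective 1)) fun n => ⟨hQB _ (by omega), ?_, hQKL _ (by omega)⟩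
    exact (hQmem 2 le_rfl).1.trans_lt (hmono (by omega : 0 < n + 1))
  · intro m hm n hn hmn
    obtain ⟨m, rfl⟩ := Nat.exists_eq_add_of_le' hm
    obtain ⟨n, rfl⟩ := Nat.exists_eq_add_of_le' hn
    exact hmono (by omega)
  · refine tendsto_order.2 ⟨fun c hc => ?_, fun c hc => ?_⟩
    · have h1 : 1 < max c qf := hq1.trans_le (le_max_right _ _)
      filter_upwards [eventually_one_lt_morseSum h1 (max_lt hc hfKL) hqKLeq,
        Filter.eventually_ge_atTop 2] with n hn hn2
      refine (le_max_left c qf).trans_lt (hroot n (by linarith [hQ1 n hn2]) ?_)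
      rwa [hQ n hn2]
    · filter_upwards [Filter.eventually_ge_atTop 2] with n hn
      exact (hQKL n hn).trans hc
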